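/- (Hoffman's duality for s⋆.) Let k be a nonempty index and k∨ its Hoffman dual. Then for every integer N≥1, s⋆(k,N) = Σ_{n=1}^{N} (−1)^{n−1} s⋆(k∨,n) · binom(N−1, n−1). -/

import Mathlib

open MeasureTheory Filter Topology

namespace Kawashima

/-- The set `A(k) = {k₁, k₁+k₂, …, k₁+⋯+k_{r-1}}` of proper nonempty partial sums
of an index `k = (k₁, …, k_r)`. -/
def Aset (k : List ℕ) : Finset ℕ :=
  (Finset.Ico 1 k.length).image (fun i => (k.take i).sum)

/-- The Hoffman dual of an index `k`: the unique index `k∨` with the same weight such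
that `A(k)` and `A(k∨)` partition `{1, …, wt(k) - 1}`.  It is computed here as the
composition of `wt(k)` whose partial-sum set is the complement of `A(k)`. -/
def hdual (k : List ℕ) : List ℕ :=
  let w := k.sum
  let L := (insert w ((Finset.Icc 1 (w - 1)) \ Aset k)).sort (· ≤ ·)
  L.zipWith (fun a b => a - b) (0 :: L)

/-- `sStar k N = s⋆(k, N) = Σ_{0 < m₁ ≤ ⋯ ≤ m_{r-1} ≤ m_r = N} 1/(m₁^{k₁} ⋯ m_r^{k_r})`.
For the empty index the value is `1` (empty product), and for a nonempty index and
`N = 0` the value is `0` (empty sum). -/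
noncomputable def sStar (k : List ℕ) (N : ℕ) : ℝ :=
  ∑ m : Fin k.length → Fin (N + 1),
    if (∀ i, 0 < (m i : ℕ)) ∧
       (∀ i j : Fin k.length, i ≤ j → (m i : ℕ) ≤ (m j : ℕ)) ∧
       (∀ i : Fin k.length, (i : ℕ) + 1 = k.length → (m i : ℕ) = N)
    then ∏ i : Fin k.length, 1 / ((m i : ℕ) : ℝ) ^ k.get i
    else 0

/-- `SStar k N = S⋆(k, N) = Σ_{n=1}^N s⋆(k, n)`. -/
noncomputable def SStar (k : List ℕ) (N : ℕ) : ℝ :=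
  ∑ n ∈ Finset.Icc 1 N, sStar k n

/-- The binomial coefficient `binom(z, n) = z(z-1)⋯(z-n+1)/n!` for complex `z`. -/
noncomputable def cbinom (z : ℂ) (n : ℕ) : ℂ :=
  (descPochhammer ℂ n).eval z / (n.factorial : ℂ)

/-- The Kawashima function
`F_k(z) = Σ_{n=1}^∞ (-1)^{n-1} s⋆(k∨, n) binom(z, n)`, with `F_∅(z) = 1`. -/
noncomputable def F (k : List ℕ) (z : ℂ) : ℂ :=
  if k = [] then 1
  else ∑' n : ℕ, (-1 : ℂ) ^ n * ((sStar (hdual k) (n + 1) : ℝ) : ℂ) * cbinom z (n + 1)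

/-- The domain `Δ(k) ⊆ (0,1)^{wt(k)}`: `t_j < t_{j+1}` if `j ∈ A(k)` and
`t_j > t_{j+1}` otherwise (positions `1`-indexed). -/
def Delta (k : List ℕ) : Set (Fin k.sum → ℝ) :=
  {t | (∀ j, t j ∈ Set.Ioo (0 : ℝ) 1) ∧
       ∀ (i : Fin k.sum) (h : (i : ℕ) + 1 < k.sum),
         if (i : ℕ) + 1 ∈ Aset k then t i < t ⟨(i : ℕ) + 1, h⟩
         else t ⟨(i : ℕ) + 1, h⟩ < t i}

/-- The multiple zeta value `ζ(k) = Σ_{0 < m₁ < ⋯ < m_r} 1/(m₁^{k₁} ⋯ m_r^{k_r})`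
(as a `tsum`; it converges for admissible `k`), with `ζ(∅) = 1`. -/
noncomputable def mzv (k : List ℕ) : ℝ :=
  ∑' m : Fin k.length → ℕ,
    if (∀ i, 0 < m i) ∧ (∀ i j : Fin k.length, i < j → m i < m j)
    then ∏ i : Fin k.length, 1 / ((m i : ℕ) : ℝ) ^ k.get i
    else 0

/-- `ζ` extended `ℚ`-linearly to formal `ℚ`-linear combinations of indices. -/
noncomputable def zetaL (v : List ℕ →₀ ℚ) : ℝ :=
  v.sum fun k a => (a : ℝ) * mzv k

/-- The Kawashima function extended `ℚ`-linearly to formal combinations of indices. -/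
noncomputable def FL (v : List ℕ →₀ ℚ) (z : ℂ) : ℂ :=
  v.sum fun k a => (a : ℂ) * F k z

/-- Auxiliary harmonic product, on *reversed* indices (so that the rightmost entry of
the index is the head of the list):
`k * l = (k₋ * l, k_r) + (k * l₋, l_s) + (k₋ * l₋, k_r + l_s)`. -/
noncomputable def hstarAux : List ℕ → List ℕ → (List ℕ →₀ ℚ)
  | [], l => Finsupp.single l 1
  | a :: k, [] => Finsupp.single (a :: k) 1
  | a :: k, b :: l =>
      Finsupp.mapDomain (List.cons a) (hstarAux k (b :: l)) +
      Finsupp.mapDomain (List.cons b) (hstarAux (a :: k) l) +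
      Finsupp.mapDomain (List.cons (a + b)) (hstarAux k l)
  termination_by k l => k.length + l.length

/-- The harmonic product `k * l` of two indices, as a `ℚ`-linear combination of
indices. -/
noncomputable def hstar (k l : List ℕ) : List ℕ →₀ ℚ :=
  Finsupp.mapDomain List.reverse (hstarAux k.reverse l.reverse)

/-- Auxiliary product `*̄` on reversed indices:
`k *̄ l = (k₋ *̄ l, k_r) + (k *̄ l₋, l_s) - (k₋ *̄ l₋, k_r + l_s)`. -/
noncomputable def hbarAux : List ℕ → List ℕ → (List ℕ →₀ ℚ)
  | [], l => Finsupp.single l 1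
  | a :: k, [] => Finsupp.single (a :: k) 1
  | a :: k, b :: l =>
      Finsupp.mapDomain (List.cons a) (hbarAux k (b :: l)) +
      Finsupp.mapDomain (List.cons b) (hbarAux (a :: k) l) -
      Finsupp.mapDomain (List.cons (a + b)) (hbarAux k l)
  termination_by k l => k.length + l.length

/-- The harmonic product `k *̄ l` of two indices. -/
noncomputable def hbar (k l : List ℕ) : List ℕ →₀ ℚ :=
  Finsupp.mapDomain List.reverse (hbarAux k.reverse l.reverse)

/-- The product `k ⊛ l = (k₋ * l₋, k_r + l_s)` for nonempty indices `k`, `l`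
(and `0` if either is empty). -/
noncomputable def circAst (k l : List ℕ) : List ℕ →₀ ℚ :=
  match k.reverse, l.reverse with
  | a :: k', b :: l' =>
      Finsupp.mapDomain List.reverse
        (Finsupp.mapDomain (List.cons (a + b)) (hstarAux k' l'))
  | _, _ => 0

/-- `⊛` extended bilinearly to formal combinations. -/
noncomputable def circAstL (v w : List ℕ →₀ ℚ) : List ℕ →₀ ℚ :=
  v.sum fun k a => w.sum fun l b => (a * b) • circAst k l

/-- The star operator `k ↦ k⋆`: the sum over all ways to replace commas by pluses
in groups of consecutive entries,
`(k₁,…,k_r)⋆ = Σ_{0<j₁<⋯<j_q=r} (k₁+⋯+k_{j₁}, …, k_{j_{q-1}+1}+⋯+k_{j_q})`. -/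
noncomputable def starOp : List ℕ → (List ℕ →₀ ℚ)
  | [] => Finsupp.single [] 1
  | [a] => Finsupp.single [a] 1
  | a :: b :: k =>
      Finsupp.mapDomain (List.cons a) (starOp (b :: k)) + starOp ((a + b) :: k)
  termination_by k => k.length

/-- The star operator extended `ℚ`-linearly. -/
noncomputable def starL (v : List ℕ →₀ ℚ) : List ℕ →₀ ℚ :=
  v.sum fun k a => a • starOp k

open Classical in
/-- Kawashima's function `G_k(z)`: the sum over tuples `0 < n₁, …, n_w` with
`n_j < n_{j+1}` if `j ∉ A(k)` and `n_j ≤ n_{j+1}` if `j ∈ A(k)`, of the product of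
the factors `1/(n_j + z)` at positions `j ∈ A(k)`, the factor
`1/n_w - 1/(n_w + z)` at the last position, and `1/n_j` elsewhere. -/
noncomputable def G (k : List ℕ) (z : ℂ) : ℂ :=
  ∑' n : Fin k.sum → ℕ,
    if (∀ j, 0 < n j) ∧
       (∀ (i : Fin k.sum) (h : (i : ℕ) + 1 < k.sum),
          if (i : ℕ) + 1 ∈ Aset k then n i ≤ n ⟨(i : ℕ) + 1, h⟩
          else n i < n ⟨(i : ℕ) + 1, h⟩)
    then ∏ j : Fin k.sum,
      if (j : ℕ) + 1 = k.sum then 1 / ((n j : ℕ) : ℂ) - 1 / (((n j : ℕ) : ℂ) + z)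
      else if (j : ℕ) + 1 ∈ Aset k then 1 / (((n j : ℕ) : ℂ) + z)
      else 1 / ((n j : ℕ) : ℂ)
    else 0

open Classical in
/-- `ζ_k(l) = Σ 1/(n₁^{l₁} ⋯ n_w^{l_w})`, summed over the same set of tuples as in
the definition of `G_k`. -/
noncomputable def zetaIdx (k : List ℕ) (l : List ℕ) : ℝ :=
  ∑' n : Fin k.sum → ℕ,
    if (∀ j, 0 < n j) ∧
       (∀ (i : Fin k.sum) (h : (i : ℕ) + 1 < k.sum),
          if (i : ℕ) + 1 ∈ Aset k then n i ≤ n ⟨(i : ℕ) + 1, h⟩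
          else n i < n ⟨(i : ℕ) + 1, h⟩)
    then ∏ j : Fin k.sum, 1 / ((n j : ℕ) : ℝ) ^ (l.getD (j : ℕ) 0)
    else 0

/-- `C_m(k) = Σ_{l₁,…,l_{r-1} ≥ 0, l_r ≥ 1, l₁+⋯+l_r = m}
ζ_k(1,…,1 (k₁-1 ones), l₁+1, …, 1,…,1 (k_r-1 ones), l_r+1)`. -/
noncomputable def Cm (k : List ℕ) (m : ℕ) : ℝ :=
  ∑ l : Fin k.length → Fin (m + 1),
    if (∑ i, (l i : ℕ)) = m ∧
       (∀ i : Fin k.length, (i : ℕ) + 1 = k.length → 1 ≤ (l i : ℕ))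
    then zetaIdx k
      ((List.ofFn (fun i : Fin k.length =>
          List.replicate (k.get i - 1) 1 ++ [(l i : ℕ) + 1])).flatten)
    else 0

/-- The iterated integral `A_m(k)` over `Δ((k,1,…,1))` (`m` trailing ones) of
`ω_{δ(1)}(t₁) ⋯ ω_{δ(w-1)}(t_{w-1}) · dt_w/(1-t_w) · dt_{w+1}/t_{w+1} ⋯ dt_{w+m}/t_{w+m}`. -/
noncomputable def Aint (k : List ℕ) (m : ℕ) : ℝ :=
  ∫ t in Delta (k ++ List.replicate m 1),
    ∏ i : Fin (k ++ List.replicate m 1).sum,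
      if (i : ℕ) + 1 < k.sum then
        (if (i : ℕ) + 1 ∈ Aset k then 1 / (1 - t i) else 1 / t i)
      else if (i : ℕ) + 1 = k.sum then 1 / (1 - t i)
      else 1 / t i

/-- The digamma function `ψ(z) = Γ'(z)/Γ(z)`. -/
noncomputable def digamma (z : ℂ) : ℂ := deriv Complex.Gamma z / Complex.Gamma z


/-- The sum defining `sStar`, for an exponent function on `Fin r`, with the last variable equal
to `n` and all variables bounded by `B`. -/
noncomputable def boundedStarSum (r : ℕ) (f : Fin r → ℕ) (B n : ℕ) : ℝ :=
  ∑ m : Fin r → Fin (B + 1),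
    if (∀ i, 0 < (m i : ℕ)) ∧
       (∀ i j : Fin r, i ≤ j → (m i : ℕ) ≤ (m j : ℕ)) ∧
       (∀ i : Fin r, (i : ℕ) + 1 = r → (m i : ℕ) = n)
    then ∏ i : Fin r, 1 / ((m i : ℕ) : ℝ) ^ f i
    else 0

lemma sStar_eq_boundedStarSum (k : List ℕ) (r : ℕ) (h : k.length = r) (N : ℕ) :
    sStar k N = boundedStarSum r (fun i => k.get (i.cast h.symm)) N N := by
  subst h
  rfl

lemma boundedStarSum_eq_of_le (r : ℕ) (f : Fin (r + 1) → ℕ) {B n : ℕ} (h : n ≤ B) :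
    boundedStarSum (r + 1) f B n = boundedStarSum (r + 1) f n n := by
  symm
  have hinj : Function.Injective
      (fun (m : Fin (r + 1) → Fin (n + 1)) i => Fin.castLE (Nat.succ_le_succ h) (m i)) := by
    intro a b hab
    funext i
    exact Fin.castLE_injective _ (congrFun hab i)
  refine Finset.sum_of_injOn _ hinj.injOn (by simp) ?_ ?_
  · intro m _ hm
    rw [if_neg]
    rintro ⟨_, h2, h3⟩
    refine hm ⟨fun i => ⟨m i, ?_⟩, by simp, rfl⟩
    have := h2 i (Fin.last r) (Fin.le_last i)
    have := h3 (Fin.last r) (by simp)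
    omega
  · intro m _
    simp

lemma boundedStarSum_succ (r : ℕ) (f : Fin (r + 2) → ℕ) {N : ℕ} (hN : 1 ≤ N) :
    boundedStarSum (r + 2) f N N = 1 / (N : ℝ) ^ f (Fin.last _) *
      ∑ n ∈ Finset.Icc 1 N, boundedStarSum (r + 1) (fun i => f i.castSucc) N n := by
  unfold boundedStarSum
  rw [← (Fin.snocEquiv (fun _ : Fin (r + 2) => Fin (N + 1))).sum_comp, Fintype.sum_prod_type,
    Finset.sum_comm (s := Finset.univ), Finset.sum_comm (s := Finset.Icc 1 N), Finset.mul_sum]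
  refine Finset.sum_congr rfl fun m _ => ?_
  rw [Finset.sum_eq_single (Fin.last N), Finset.mul_sum]
  · by_cases hm : (∀ i, 0 < (m i : ℕ)) ∧ (∀ i j : Fin (r + 1), i ≤ j → (m i : ℕ) ≤ (m j : ℕ))
    · obtain ⟨h1, h2⟩ := hm
      rw [if_pos, Finset.sum_eq_single (m (Fin.last r) : ℕ), if_pos]
      · rw [Fin.prod_univ_castSucc, mul_comm]
        simp [Fin.snocEquiv]
      · refine ⟨h1, h2, fun i hi => ?_⟩
        rw [show i = Fin.last r from Fin.ext (by simpa using hi)]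
      · intro n _ hn
        rw [if_neg, mul_zero]
        rintro ⟨-, -, h3⟩
        exact hn (h3 (Fin.last r) (by simp)).symm
      · intro h
        refine absurd (Finset.mem_Icc.2 ⟨h1 _, ?_⟩) h
        have := (m (Fin.last r)).isLt
        omega
      · refine ⟨fun i => ?_, fun i j hij => ?_, fun i hi => ?_⟩
        · induction i using Fin.lastCases with
          | last => simpa [Fin.snocEquiv] using Nat.pos_of_ne_zero (by omega)
          | cast i => simpa [Fin.snocEquiv] using h1 i
        · induction j using Fin.lastCases with
          | last =>
            simp only [Fin.snocEquiv, Equiv.coe_fn_mk, Fin.snoc_last]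
            exact Nat.le_of_lt_succ (Fin.isLt _)
          | cast j =>
            induction i using Fin.lastCases with
            | last =>
              have := Fin.le_def.1 hij
              have := j.isLt
              simp at *
            | cast i => simpa [Fin.snocEquiv] using h2 i j (by simpa using hij)
        · rw [show i = Fin.last (r + 1) from Fin.ext (by simpa using hi)]
          simp [Fin.snocEquiv]
    · rw [if_neg, Finset.sum_eq_zero]
      · intro n _
        rw [if_neg, mul_zero]
        exact fun h => hm ⟨h.1, h.2.1⟩
      · rintro ⟨h1, h2, -⟩
        refine hm ⟨fun i => ?_, fun i j hij => ?_⟩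
        · simpa [Fin.snocEquiv] using h1 i.castSucc
        · simpa [Fin.snocEquiv] using h2 i.castSucc j.castSucc (by simpa using hij)
  · intro x _ hx
    rw [if_neg]
    rintro ⟨-, -, h3⟩
    have := h3 (Fin.last (r + 1)) (by simp)
    refine hx (Fin.ext ?_)
    simpa [Fin.snocEquiv] using this
  · simp

lemma sStar_append_singleton {l : List ℕ} (hl : l ≠ []) (a : ℕ) {N : ℕ} (hN : 1 ≤ N) :
    sStar (l ++ [a]) N = 1 / (N : ℝ) ^ a * ∑ n ∈ Finset.Icc 1 N, sStar l n := by
  obtain ⟨r, hr⟩ : ∃ r, l.length = r + 1 :=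
    ⟨l.length - 1, by have := List.length_pos_iff.2 hl; omega⟩
  rw [sStar_eq_boundedStarSum _ (r + 2) (by simp [hr]), boundedStarSum_succ r _ hN]
  congr 1
  · simp [← hr]
  · refine Finset.sum_congr rfl fun n hn => ?_
    rw [boundedStarSum_eq_of_le r _ (Finset.mem_Icc.1 hn).2,
      sStar_eq_boundedStarSum _ (r + 1) hr]
    congr 1
    funext i
    simp [hr, Fin.is_le i]

lemma sStar_singleton (a : ℕ) {N : ℕ} (hN : 1 ≤ N) : sStar [a] N = 1 / (N : ℝ) ^ a := by
  rw [sStar_eq_boundedStarSum _ 1 rfl, boundedStarSum,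
    Finset.sum_eq_single (fun _ => Fin.last N)]
  · simp; omega
  · intro m _ hm
    rw [if_neg]
    rintro ⟨-, -, h3⟩
    refine hm (funext fun i => Fin.ext ?_)
    simpa using h3 i (by omega)
  · simp

lemma sStar_append_succ (l : List ℕ) (b : ℕ) {N : ℕ} (hN : 1 ≤ N) :
    sStar (l ++ [b + 1]) N = 1 / (N : ℝ) * sStar (l ++ [b]) N := by
  rcases eq_or_ne l [] with rfl | hl
  · simp only [List.nil_append, sStar_singleton _ hN]
    rw [pow_succ]; ring
  · rw [sStar_append_singleton hl _ hN, sStar_append_singleton hl _ hN, pow_succ]; ring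

lemma sStar_append_one {l : List ℕ} (hl : l ≠ []) {N : ℕ} (hN : 1 ≤ N) :
    sStar (l ++ [1]) N = 1 / (N : ℝ) * ∑ n ∈ Finset.Icc 1 N, sStar l n := by
  rw [sStar_append_singleton hl _ hN, pow_one]

/-- The list of successive differences of `L`, starting from `0`. -/
def diffs (L : List ℕ) : List ℕ := L.zipWith (fun a b => a - b) (0 :: L)

lemma zipWith_sub_cons_append (L : List ℕ) (w x : ℕ) :
    (L ++ [w]).zipWith (fun a b => a - b) (x :: (L ++ [w])) =
      L.zipWith (fun a b => a - b) (x :: L) ++ [w - L.getLastD x] := by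
  induction L generalizing x with
  | nil => simp
  | cons y L ih =>
    simp only [List.cons_append, List.zipWith_cons_cons, ih y, List.getLastD_cons]

lemma diffs_append (L : List ℕ) (w : ℕ) :
    diffs (L ++ [w]) = diffs L ++ [w - L.getLastD 0] :=
  zipWith_sub_cons_append L w 0

lemma sort_insert_of_lt (S : Finset ℕ) (w : ℕ) (h : ∀ x ∈ S, x < w) :
    (insert w S).sort (· ≤ ·) = S.sort (· ≤ ·) ++ [w] := by
  have hw : w ∉ S := fun hw => lt_irrefl _ (h w hw)
  refine List.Perm.eq_of_pairwise (le := (· ≤ ·)) (fun a b _ _ => le_antisymm)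
    (Finset.pairwise_sort _ _) ?_ ?_
  · rw [List.pairwise_append]
    refine ⟨Finset.pairwise_sort _ _, List.pairwise_singleton _ _, fun a ha b hb => ?_⟩
    rw [List.mem_singleton.1 hb]
    exact (h a ((Finset.mem_sort _).1 ha)).le
  · rw [← Multiset.coe_eq_coe, Finset.sort_eq, Finset.insert_val_of_notMem hw,
      ← Multiset.coe_add, Finset.sort_eq, Multiset.coe_singleton, add_comm,
      Multiset.singleton_add]

/-- The elements of `{1, …, wt(k) - 1}` outside `A(k)`. -/
def complAset (k : List ℕ) : Finset ℕ := Finset.Icc 1 (k.sum - 1) \ Aset k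

lemma hdual_eq (k : List ℕ) (hk : 0 < k.sum) :
    hdual k = diffs ((complAset k).sort (· ≤ ·)) ++
      [k.sum - ((complAset k).sort (· ≤ ·)).getLastD 0] := by
  rw [← diffs_append, ← sort_insert_of_lt]
  · rfl
  · intro x hx
    have := (Finset.mem_Icc.1 (Finset.mem_sdiff.1 hx).1).2
    omega

lemma mem_Aset_append_singleton (l : List ℕ) (a x : ℕ) :
    x ∈ Aset (l ++ [a]) ↔ ∃ i, 1 ≤ i ∧ i ≤ l.length ∧ (l.take i).sum = x := by
  simp only [Aset, Finset.mem_image, Finset.mem_Ico, List.length_append, List.length_singleton]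
  refine exists_congr fun i => ⟨fun ⟨⟨h1, h2⟩, h3⟩ => ⟨h1, by omega, ?_⟩,
    fun ⟨h1, h2, h3⟩ => ⟨⟨h1, by omega⟩, ?_⟩⟩
  · rwa [List.take_append_of_le_length (by omega)] at h3
  · rwa [List.take_append_of_le_length h2]

lemma sum_take_le (l : List ℕ) (i : ℕ) : (l.take i).sum ≤ l.sum := by
  conv_rhs => rw [← List.take_append_drop i l, List.sum_append]
  omega

lemma le_sum_of_mem_Aset_append {l : List ℕ} {a x : ℕ} (h : x ∈ Aset (l ++ [a])) :
    x ≤ l.sum := by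
  obtain ⟨i, -, -, rfl⟩ := (mem_Aset_append_singleton l a x).1 h
  exact sum_take_le l i

lemma complAset_append_succ (l : List ℕ) {b : ℕ} (hb : 0 < b) :
    complAset (l ++ [b + 1]) = insert (l ++ [b]).sum (complAset (l ++ [b])) := by
  have hA : Aset (l ++ [b + 1]) = Aset (l ++ [b]) := by
    ext x; simp only [mem_Aset_append_singleton]
  have hs (c : ℕ) : (l ++ [c]).sum = l.sum + c := by simp
  ext x
  have := le_sum_of_mem_Aset_append (l := l) (a := b) (x := x)
  simp only [complAset, hA, Finset.mem_sdiff, Finset.mem_Icc, Finset.mem_insert, hs]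
  by_cases hx : x ∈ Aset (l ++ [b])
  · have := this hx
    simp only [hx, not_true_eq_false, and_false, or_false, false_iff]
    omega
  · simp only [hx, not_false_eq_true, and_true]
    omega

lemma complAset_append_one {l : List ℕ} (hl : l ≠ []) :
    complAset (l ++ [1]) = complAset l := by
  have hlen := List.length_pos_iff.2 hl
  have hA : Aset (l ++ [1]) = insert l.sum (Aset l) := by
    ext x
    rw [mem_Aset_append_singleton]
    simp only [Aset, Finset.mem_insert, Finset.mem_image, Finset.mem_Ico]
    constructor
    · rintro ⟨i, h1, h2, h3⟩
      rcases h2.eq_or_lt with rfl | h2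
      · left; simpa using h3.symm
      · exact Or.inr ⟨i, ⟨h1, h2⟩, h3⟩
    · rintro (rfl | ⟨i, ⟨h1, h2⟩, h3⟩)
      · exact ⟨l.length, hlen, le_rfl, by simp⟩
      · exact ⟨i, h1, h2.le, h3⟩
  have hs : (l ++ [1]).sum = l.sum + 1 := by simp
  ext x
  simp only [complAset, hA, Finset.mem_sdiff, Finset.mem_Icc, Finset.mem_insert, hs]
  by_cases hx : x ∈ Aset l
  · simp [hx]
  · simp only [hx, not_false_eq_true, and_true, or_false]
    omega

lemma lt_sum_of_mem_complAset {k : List ℕ} {x : ℕ} (hx : x ∈ complAset k) : x < k.sum := by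
  have := Finset.mem_Icc.1 (Finset.mem_sdiff.1 hx).1
  omega

lemma hdual_ne_nil {k : List ℕ} (hk : 0 < k.sum) : hdual k ≠ [] := by
  simp [hdual_eq k hk]

lemma hdual_append_succ (l : List ℕ) {b : ℕ} (hb : 0 < b) :
    hdual (l ++ [b + 1]) = hdual (l ++ [b]) ++ [1] := by
  have hsum : (l ++ [b + 1]).sum = (l ++ [b]).sum + 1 := by simp; omega
  rw [hdual_eq (l ++ [b + 1]) (by simp), complAset_append_succ l hb,
    sort_insert_of_lt _ _ fun _ => lt_sum_of_mem_complAset, diffs_append,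
    hdual_eq (l ++ [b]) (by simp; omega), hsum]
  simp

lemma exists_hdual_append_one {l : List ℕ} (hl : l ≠ []) (hs : 0 < l.sum) :
    ∃ D b, hdual l = D ++ [b] ∧ hdual (l ++ [1]) = D ++ [b + 1] := by
  refine ⟨_, _, hdual_eq l hs, ?_⟩
  rw [hdual_eq _ (by simp), complAset_append_one hl]
  have : ((complAset l).sort (· ≤ ·)).getLastD 0 ≤ l.sum := by
    rcases eq_or_ne ((complAset l).sort (· ≤ ·)) [] with h | h
    · simp [h]
    · rw [List.getLastD_eq_getLast?, List.getLast?_eq_getLast_of_ne_nil h, Option.getD_some]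
      exact (lt_sum_of_mem_complAset ((Finset.mem_sort _).1 (List.getLast_mem h))).le
  simp only [List.sum_append, List.sum_singleton]
  rw [Nat.sub_add_comm this]

lemma hdual_singleton_one : hdual [1] = [1] := by
  have h : complAset [1] = ∅ := by simp [complAset]
  simp [hdual_eq [1] (by simp), h, diffs]

/-- The alternating binomial transform of a sequence indexed by positive integers. -/
noncomputable def binomTransform (f : ℕ → ℝ) (N : ℕ) : ℝ :=
  ∑ n ∈ Finset.Icc 1 N, (-1 : ℝ) ^ (n - 1) * f n * ((N - 1).choose (n - 1) : ℕ)

lemma sum_Icc_one_eq_sum_range (f : ℕ → ℝ) (N : ℕ) :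
    ∑ n ∈ Finset.Icc 1 N, f n = ∑ i ∈ Finset.range N, f (i + 1) := by
  rw [Finset.range_eq_Ico, Finset.sum_Ico_add' f 0 N 1]
  rfl

lemma binomTransform_congr {f g : ℕ → ℝ} {N : ℕ} (h : ∀ n, 1 ≤ n → f n = g n) :
    binomTransform f N = binomTransform g N :=
  Finset.sum_congr rfl fun n hn => by rw [h n (Finset.mem_Icc.1 hn).1]

lemma binomTransform_succ (f : ℕ → ℝ) (M : ℕ) :
    binomTransform f (M + 1) =
      ∑ i ∈ Finset.range (M + 1), (-1 : ℝ) ^ i * f (i + 1) * (M.choose i : ℕ) := by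
  rw [binomTransform, sum_Icc_one_eq_sum_range]
  simp

lemma binomTransform_div_eq_sum_choose_succ (f : ℕ → ℝ) (M : ℕ) :
    binomTransform (fun n => 1 / (n : ℝ) * f n) (M + 1) = 1 / ((M + 1 : ℕ) : ℝ) *
      ∑ i ∈ Finset.range (M + 1), (-1 : ℝ) ^ i * f (i + 1) * ((M + 1).choose (i + 1) : ℕ) := by
  rw [binomTransform_succ, Finset.mul_sum]
  refine Finset.sum_congr rfl fun i _ => ?_
  have h : ((M + 1 : ℕ) : ℝ) * (M.choose i : ℕ) =
      ((M + 1).choose (i + 1) : ℕ) * ((i + 1 : ℕ) : ℝ) := by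
    exact_mod_cast Nat.add_one_mul_choose_eq M i
  have hM : ((M + 1 : ℕ) : ℝ) ≠ 0 := by positivity
  have hi : ((i + 1 : ℕ) : ℝ) ≠ 0 := by positivity
  field_simp
  linear_combination f (i + 1) * h

lemma binomTransform_div_sum (f : ℕ → ℝ) {N : ℕ} (hN : 1 ≤ N) :
    binomTransform (fun n => 1 / (n : ℝ) * ∑ j ∈ Finset.Icc 1 n, f j) N =
      1 / (N : ℝ) * binomTransform f N := by
  obtain ⟨M, rfl⟩ := Nat.exists_eq_add_of_le' hN
  rw [binomTransform_div_eq_sum_choose_succ (fun n => ∑ j ∈ Finset.Icc 1 n, f j), binomTransform_succ]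
  congr 1
  have key : ∀ K, ∑ i ∈ Finset.range (K + 1),
        (-1 : ℝ) ^ i * (∑ j ∈ Finset.Icc 1 (i + 1), f j) * ((M + 1).choose (i + 1) : ℕ) =
      ∑ i ∈ Finset.range (K + 1), (-1 : ℝ) ^ i * f (i + 1) * (M.choose i : ℕ) +
        (-1) ^ K * (M.choose (K + 1) : ℕ) * ∑ j ∈ Finset.Icc 1 (K + 1), f j := by
    intro K
    induction K with
    | zero => simp; ring
    | succ K ih =>
      rw [Finset.sum_range_succ, ih, Finset.sum_range_succ _ (K + 1),
        Finset.sum_Icc_succ_top (b := K + 1) (by omega), Nat.choose_succ_succ M (K + 1)]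
      push_cast
      ring
  rw [key M]
  simp

lemma binomTransform_div (f : ℕ → ℝ) {N : ℕ} (hN : 1 ≤ N) :
    binomTransform (fun n => 1 / (n : ℝ) * f n) N =
      1 / (N : ℝ) * ∑ n ∈ Finset.Icc 1 N, binomTransform f n := by
  obtain ⟨M, rfl⟩ := Nat.exists_eq_add_of_le' hN
  rw [binomTransform_div_eq_sum_choose_succ, sum_Icc_one_eq_sum_range]
  congr 1
  clear hN
  induction M with
  | zero => simp [binomTransform]
  | succ M ih =>
    rw [Finset.sum_range_succ (fun i => binomTransform f (i + 1)), ← ih, binomTransform_succ,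
      Finset.sum_congr rfl fun i _ => by rw [Nat.choose_succ_succ (M + 1) i, Nat.cast_add, mul_add],
      Finset.sum_add_distrib, add_comm]
    congr 1
    rw [Finset.sum_range_succ]
    simp

lemma binomTransform_one_div {N : ℕ} (hN : 1 ≤ N) :
    binomTransform (fun n => 1 / (n : ℝ)) N = 1 / (N : ℝ) := by
  have h := binomTransform_div_sum (fun n => if n = 1 then 1 else 0) hN
  have h1 : binomTransform (fun n => if n = 1 then 1 else 0) N = 1 := by
    rw [binomTransform, Finset.sum_eq_single_of_mem 1 (Finset.mem_Icc.2 ⟨le_rfl, hN⟩)]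
    · simp
    · intro n _ hn
      simp [hn]
  rw [h1, mul_one] at h
  rw [← h]
  refine binomTransform_congr fun n hn => ?_
  rw [Finset.sum_ite_eq' (Finset.Icc 1 n), if_pos (Finset.mem_Icc.2 ⟨le_rfl, hn⟩), mul_one]

lemma sStar_eq_binomTransform (k : List ℕ) (hk : k ≠ []) (hpos : ∀ x ∈ k, 0 < x)
    (N : ℕ) (hN : 1 ≤ N) : sStar k N = binomTransform (sStar (hdual k)) N := by
  induction hw : k.sum using Nat.strong_induction_on generalizing k N with
  | _ w ih =>
    obtain ⟨l, a, rfl⟩ : ∃ l a, k = l ++ [a] :=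
      ⟨_, _, (List.dropLast_append_getLast hk).symm⟩
    obtain ⟨b, rfl⟩ : ∃ b, a = b + 1 := ⟨a - 1, by have := hpos a (by simp); omega⟩
    rcases Nat.eq_zero_or_pos b with rfl | hb
    · rcases eq_or_ne l [] with rfl | hl
      · simp only [List.nil_append, zero_add, hdual_singleton_one]
        rw [sStar_singleton _ hN, pow_one, ← binomTransform_one_div hN]
        exact binomTransform_congr fun n hn => by rw [sStar_singleton _ hn, pow_one]
      · have hlpos : ∀ x ∈ l, 0 < x := fun x hx => hpos x (by simp [hx])
        obtain ⟨D, b, h1, h2⟩ := exists_hdual_append_one hl (List.sum_pos l hlpos hl)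
        rw [zero_add, h2, sStar_append_one hl hN,
          binomTransform_congr fun n hn => sStar_append_succ D b hn, ← h1, binomTransform_div _ hN]
        congr 1
        refine Finset.sum_congr rfl fun n hn => ?_
        refine ih l.sum ?_ l hl hlpos n (Finset.mem_Icc.1 hn).1 rfl
        simp [← hw]
    · rw [hdual_append_succ l hb, sStar_append_succ l b hN,
        binomTransform_congr fun n hn => sStar_append_one (hdual_ne_nil (by simp; omega)) hn,
        binomTransform_div_sum _ hN]
      congr 1
      refine ih (l ++ [b]).sum ?_ (l ++ [b]) (by simp) ?_ N hN rfl
      · simp [← hw]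
      · intro x hx
        rcases List.mem_append.1 hx with hx | hx
        · exact hpos x (by simp [hx])
        · rwa [List.mem_singleton.1 hx]

/-- Hoffman's duality for `s⋆`:
`s⋆(k,N) = Σ_{n=1}^N (-1)^{n-1} s⋆(k∨,n) · binom(N-1, n-1)`. -/
theorem sStar_hoffman_duality (k : List ℕ) (hk : k ≠ []) (hpos : ∀ x ∈ k, 0 < x)
    (N : ℕ) (hN : 1 ≤ N) :
    sStar k N =
      ∑ n ∈ Finset.Icc 1 N,
        (-1 : ℝ) ^ (n - 1) * sStar (hdual k) n * ((N - 1).choose (n - 1) : ℕ) := by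
  exact sStar_eq_binomTransform k hk hpos N hN

end Kawashima
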